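/- arXiv:2011.14571 — 2 statements merged into one kernel-verified Lean document; each statement's English description precedes it below -/
import Mathlib

section
/- Suppose M, σ, r, l are positive real constants with rσ² ≥ M². Define u(q) = (q(1−p)/(p(1−q)))^a for q ∈ (0,p). Then u satisfies the differential equation −r·u(q) + (q²(1−q)²M²/(2σ²))·u''(q) + (q(1−q)²M²/σ²)·u'(q) = 0 for all q ∈ (0,p); moreover u(q) → 0 as q → 0⁺ and u(q) → 1 as q → p⁻. -/
/-- A constant multiple of the odds ratio, raised to the power `a`, has logarithmic derivative
`a / (q (1 - q))`. -/
lemma hasDerivAt_odds_rpow {p q : ℝ} (a : ℝ) (hp0 : 0 < p) (hp1 : p < 1) (hq0 : 0 < q)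
    (hq1 : q < 1) :
    HasDerivAt (fun x : ℝ => (x * (1 - p) / (p * (1 - x))) ^ a)
      (a * (q * (1 - p) / (p * (1 - q))) ^ a / (q * (1 - q))) q := by
  have h1p : 0 < 1 - p := sub_pos.2 hp1
  have h1q : 0 < 1 - q := sub_pos.2 hq1
  have hbase : 0 < q * (1 - p) / (p * (1 - q)) := by positivity
  have hnum : HasDerivAt (fun x : ℝ => x * (1 - p)) (1 * (1 - p)) q :=
    (hasDerivAt_id q).mul_const (1 - p)
  have hden : HasDerivAt (fun x : ℝ => p * (1 - x)) (p * -1) q :=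
    ((hasDerivAt_id q).const_sub 1).const_mul p
  have hpow := (hnum.fun_div hden (by positivity)).rpow_const (p := a) (Or.inl hbase.ne')
  refine hpow.congr_deriv ?_
  rw [Real.rpow_sub_one hbase.ne']
  generalize (q * (1 - p) / (p * (1 - q))) ^ a = U
  field_simp
  ring

/-- In the regime `rσ² ≥ M²`, with `p = (1+a)rl/((1+a)rl + aM)`, the function
`u(q) = (q(1−p)/(p(1−q)))^a` satisfies
`−ru + (q²(1−q)²M²/(2σ²))u'' + (q(1−q)²M²/σ²)u' = 0` on `(0,p)`, with `u(q) → 0` as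
`q → 0⁺` and `u(q) → 1` as `q → p⁻`. -/
theorem stmt_12 (M σ r l : ℝ) (hM : 0 < M) (hσ : 0 < σ) (hr : 0 < r) (hl : 0 < l)
    (hreg : M ^ 2 ≤ r * σ ^ 2) (a p : ℝ)
    (ha : a = (1 / 2) * (Real.sqrt (1 + 8 * r * σ ^ 2 / M ^ 2) - 1))
    (hp : p = (1 + a) * r * l / ((1 + a) * r * l + a * M))
    (u : ℝ → ℝ)
    (hu : ∀ q, u q = (q * (1 - p) / (p * (1 - q))) ^ a) :
    (∀ q ∈ Set.Ioo (0:ℝ) p,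
      -r * u q + (q ^ 2 * (1 - q) ^ 2 * M ^ 2 / (2 * σ ^ 2)) * deriv (deriv u) q
        + (q * (1 - q) ^ 2 * M ^ 2 / σ ^ 2) * deriv u q = 0) ∧
    Filter.Tendsto u (nhdsWithin 0 (Set.Ioi 0)) (nhds 0) ∧
    Filter.Tendsto u (nhdsWithin p (Set.Iio p)) (nhds 1) := by
  have hs : Real.sqrt (1 + 8 * r * σ ^ 2 / M ^ 2) ^ 2 = 1 + 8 * r * σ ^ 2 / M ^ 2 :=
    Real.sq_sqrt (by positivity)
  have ha0 : 0 < a := by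
    have : 1 < Real.sqrt (1 + 8 * r * σ ^ 2 / M ^ 2) := by
      rw [Real.lt_sqrt zero_le_one]
      have : 0 < 8 * r * σ ^ 2 / M ^ 2 := by positivity
      linarith
    rw [ha]
    linarith
  have hquad : a * (a + 1) * M ^ 2 = 2 * r * σ ^ 2 := by
    have hsM : (Real.sqrt (1 + 8 * r * σ ^ 2 / M ^ 2) ^ 2 - 1) * M ^ 2 = 8 * r * σ ^ 2 := by
      rw [hs]
      field_simp
      ring
    rw [ha]
    linear_combination hsM / 4
  have hp0 : 0 < p := by
    rw [hp]
    positivity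
  have hp1 : p < 1 := by
    rw [hp, div_lt_one (by positivity)]
    have : 0 < a * M := by positivity
    linarith
  have hderiv : ∀ q ∈ Set.Ioo (0 : ℝ) 1, HasDerivAt u (a * u q / (q * (1 - q))) q := by
    intro q hq
    obtain rfl : u = fun x => (x * (1 - p) / (p * (1 - x))) ^ a := funext hu
    exact hasDerivAt_odds_rpow a hp0 hp1 hq.1 hq.2
  refine ⟨?_, ?_, ?_⟩
  · intro q hq
    have hq0 : 0 < q := hq.1
    have hq1 : q < 1 := hq.2.trans hp1
    have h1q : 0 < 1 - q := sub_pos.2 hq1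
    have hder := hderiv q ⟨hq0, hq1⟩
    have heq : deriv u =ᶠ[nhds q] fun x => a * u x / (x * (1 - x)) := by
      filter_upwards [Ioo_mem_nhds hq0 hq1] with x hx using (hderiv x hx).deriv
    have hden : HasDerivAt (fun x : ℝ => x * (1 - x)) (1 * (1 - q) + q * -1) q :=
      (hasDerivAt_id q).fun_mul ((hasDerivAt_id q).const_sub 1)
    have hder2 := (hder.const_mul a).fun_div hden (by positivity)
    rw [heq.deriv_eq, hder2.deriv, hder.deriv]
    field_simp
    linear_combination u q * hquad
  · have hcont : ContinuousAt u 0 := by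
      rw [funext hu]
      refine ContinuousAt.rpow_const (ContinuousAt.div (by fun_prop) (by fun_prop) ?_)
        (Or.inr ha0.le)
      simpa using hp0.ne'
    have h0 : u 0 = 0 := by simp [hu, Real.zero_rpow ha0.ne']
    have hlim := hcont.tendsto
    rw [h0] at hlim
    exact hlim.mono_left nhdsWithin_le_nhds
  · have h1 : u p = 1 := by
      rw [hu, div_self (mul_pos hp0 (sub_pos.2 hp1)).ne', Real.one_rpow]
    rw [← h1]
    exact (hderiv p ⟨hp0, hp1⟩).continuousAt.tendsto.mono_left nhdsWithin_le_nhds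
end

section
/- Suppose M, σ, r, l are positive real constants with rσ² < M². Let y : (q*, p] → ℝ satisfy y ≥ 0 and φ(y(q)) = c(p − q)/(p(1 − q)) for all q ∈ (q*, p]. Then e^{−y(q)²} − c√π·((1−p)q/(p(1−q)))·y(q) ≥ 0 for all q ∈ (q*, p]; in particular its value at q = q* equals a·e^{−b²} > 0. -/
/-- The Gauss error function `erf x = (2/√π) ∫₀ˣ e^{−t²} dt`. -/
noncomputable def erf (x : ℝ) : ℝ :=
  (2 / Real.sqrt Real.pi) * ∫ t in (0:ℝ)..x, Real.exp (-t ^ 2)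

theorem hasDerivAt_erf (x : ℝ) :
    HasDerivAt erf (2 / Real.sqrt Real.pi * Real.exp (-x ^ 2)) x := by
  have hcont : Continuous fun t : ℝ => Real.exp (-t ^ 2) := by fun_prop
  exact (intervalIntegral.integral_hasDerivAt_right (hcont.intervalIntegrable 0 x)
    (hcont.stronglyMeasurableAtFilter _ _) hcont.continuousAt).const_mul _

theorem erf_monotone : Monotone erf := by
  refine monotone_of_deriv_nonneg (fun x => (hasDerivAt_erf x).differentiableAt) fun x => ?_
  rw [(hasDerivAt_erf x).deriv]
  positivity

theorem erf_zero : erf 0 = 0 := by simp [erf]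

theorem hasDerivAt_exp_sub_mul_erf (c x : ℝ) :
    HasDerivAt (fun x => Real.exp (-x ^ 2) - Real.sqrt Real.pi * (c - erf x) * x)
      (-(Real.sqrt Real.pi * (c - erf x))) x := by
  have hpi : Real.sqrt Real.pi ≠ 0 := (Real.sqrt_pos.2 Real.pi_pos).ne'
  have hexp : HasDerivAt (fun x : ℝ => Real.exp (-x ^ 2))
      (Real.exp (-x ^ 2) * (-(2 * x))) x := by
    simpa using ((hasDerivAt_pow 2 x).neg).exp
  have hmul := (((hasDerivAt_erf x).const_sub c).const_mul (Real.sqrt Real.pi)).mul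
    (hasDerivAt_id x)
  refine (hexp.sub hmul).congr_deriv ?_
  simp only [id]
  field_simp
  ring

theorem exp_sub_mul_erf_antitoneOn {b c : ℝ} (h : erf b ≤ c) :
    AntitoneOn (fun x => Real.exp (-x ^ 2) - Real.sqrt Real.pi * (c - erf x) * x)
      (Set.Iic b) := by
  refine antitoneOn_of_deriv_nonpos (convex_Iic b)
    (fun x _ => (hasDerivAt_exp_sub_mul_erf c x).continuousAt.continuousWithinAt)
    (fun x _ => (hasDerivAt_exp_sub_mul_erf c x).differentiableAt.differentiableWithinAt) ?_
  intro x hx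
  have hxb : x ≤ b := Set.mem_Iic.1 (interior_subset hx)
  rw [(hasDerivAt_exp_sub_mul_erf c x).deriv, neg_nonpos]
  exact mul_nonneg (Real.sqrt_nonneg _)
    (sub_nonneg.2 ((erf_monotone hxb).trans h))

/-- In the regime `rσ² < M²`, with `y ≥ 0` on `(q*,p]` satisfying
`φ(y(q)) = c(p−q)/(p(1−q))`, one has `e^{−y(q)²} − c√π((1−p)q/(p(1−q))) y(q) ≥ 0` for all
`q ∈ (q*,p]`; in particular the value of this expression at `q = q*` (where `y(q*) = b`)
equals `a e^{−b²} > 0`. -/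
theorem stmt_16 (M σ r l : ℝ) (hM : 0 < M) (hσ : 0 < σ) (hr : 0 < r) (hl : 0 < l)
    (hreg : r * σ ^ 2 < M ^ 2) (a b c p qstar : ℝ)
    (ha : a = (1 / 2) * (Real.sqrt (1 + 8 * r * σ ^ 2 / M ^ 2) - 1))
    (hb : b = (1 - a) * M / (2 * σ * Real.sqrt r))
    (hc : c = (2 * σ * Real.sqrt r * Real.exp (-b ^ 2)) / (M * Real.sqrt Real.pi) + erf b)
    (hp : p = c * l * Real.sqrt (Real.pi * r) / (c * l * Real.sqrt (Real.pi * r) + σ))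
    (hqs : qstar = p * (c - erf b) / (c - p * erf b))
    (y : ℝ → ℝ)
    (hy0 : ∀ q ∈ Set.Ioc qstar p, 0 ≤ y q)
    (herf : ∀ q ∈ Set.Ioc qstar p, erf (y q) = c * (p - q) / (p * (1 - q))) :
    (∀ q ∈ Set.Ioc qstar p,
      0 ≤ Real.exp (-(y q) ^ 2)
        - c * Real.sqrt Real.pi * ((1 - p) * q / (p * (1 - q))) * y q) ∧
    Real.exp (-b ^ 2) - c * Real.sqrt Real.pi * ((1 - p) * qstar / (p * (1 - qstar))) * b
      = a * Real.exp (-b ^ 2) ∧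
    0 < a * Real.exp (-b ^ 2) := by
  have hpi : 0 < Real.sqrt Real.pi := Real.sqrt_pos.2 Real.pi_pos
  have hsr : 0 < Real.sqrt r := Real.sqrt_pos.2 hr
  have hs : 0 < 8 * r * σ ^ 2 / M ^ 2 := by positivity
  have ha0 : 0 < a := by
    have : 1 < Real.sqrt (1 + 8 * r * σ ^ 2 / M ^ 2) := by
      rw [Real.lt_sqrt (by norm_num)]
      linarith
    linarith
  have ha1 : a < 1 := by
    have : Real.sqrt (1 + 8 * r * σ ^ 2 / M ^ 2) < 3 := by
      rw [Real.sqrt_lt' (by norm_num)]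
      have : 8 * r * σ ^ 2 / M ^ 2 < 8 := by
        rw [div_lt_iff₀ (by positivity)]
        linarith
      linarith
    linarith
  have hb0 : 0 < b := by
    have : 0 < 1 - a := by linarith
    rw [hb]
    positivity
  have he0 : 0 ≤ erf b := erf_zero ▸ erf_monotone hb0.le
  have hk : 0 < c - erf b := by
    have : 0 < 2 * σ * Real.sqrt r * Real.exp (-b ^ 2) / (M * Real.sqrt Real.pi) := by positivity
    linarith
  have hc0 : 0 < c := by linarith
  have hw : 0 < c * l * Real.sqrt (Real.pi * r) := by
    have := Real.sqrt_pos.2 (mul_pos Real.pi_pos hr)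
    positivity
  have hp0 : 0 < p := by rw [hp]; positivity
  have hp1 : p < 1 := by
    rw [hp, div_lt_one (by positivity)]
    linarith
  have hd : 0 < c - p * erf b := by nlinarith
  have hpos : 0 < a * Real.exp (-b ^ 2) := by positivity
  have hval : Real.exp (-b ^ 2) - Real.sqrt Real.pi * (c - erf b) * b
      = a * Real.exp (-b ^ 2) := by
    have h1 : Real.sqrt Real.pi * (c - erf b) * b = (1 - a) * Real.exp (-b ^ 2) := by
      have h2 : c - erf b
          = 2 * σ * Real.sqrt r * Real.exp (-b ^ 2) / (M * Real.sqrt Real.pi) := by linarith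
      have h3 : b * (2 * σ * Real.sqrt r) = (1 - a) * M := by
        rw [hb]
        field_simp
      rw [h2]
      generalize Real.exp (-b ^ 2) = e
      field_simp
      linear_combination e * h3
    linarith
  refine ⟨fun q hq => ?_, ?_, hpos⟩
  · have hq1 : 0 < 1 - q := by linarith [hq.2]
    have hcomp : c - erf (y q) = c * ((1 - p) * q / (p * (1 - q))) := by
      rw [herf q hq]
      field_simp
      ring
    have hlt : erf (y q) < erf b := by
      have hq0 : p * (c - erf b) < q * (c - p * erf b) := by
        rw [← div_lt_iff₀ hd, ← hqs]
        exact hq.1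
      rw [herf q hq, div_lt_iff₀ (by positivity)]
      linarith
    have hyb : y q ≤ b := (erf_monotone.reflect_lt hlt).le
    have hle := exp_sub_mul_erf_antitoneOn (sub_nonneg.1 hk.le) hyb Set.self_mem_Iic hyb
    simp only [hval, hcomp] at hle
    linarith
  · have h1 : 1 - qstar = c * (1 - p) / (c - p * erf b) := by
      rw [hqs]
      field_simp
      ring
    have h2 : (1 - p) * qstar / (p * (1 - qstar)) = (c - erf b) / c := by
      have : 1 - p ≠ 0 := by linarith
      rw [h1, hqs]
      field_simp
    rw [h2, ← hval]
    field_simp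
end
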